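/- (Cancellation identity for the ZDM, equation (3.8) in the proof of Theorem 1.) Let X : ℝⁿ → ℝⁿ be a C³ vector field, H : ℝⁿ → ℝ smooth, and x* a regular grazing point of order 4 (L_XH(x*) = L_X²H(x*) = L_X³H(x*) = 0 and L_X⁴H(x*) > 0). Let W : ℝⁿ → ℝⁿ be smooth and R(x) = x + L_XH(x)·W(x). Let x₁ : (0,ε₀) → ℝⁿ satisfy x₁(ε) ∈ Π₃, H(x₁(ε)) = -ε, and ‖x₁(ε) - x*‖ = O(ε) as ε → 0⁺, and let δ : (0,ε₀) → ℝ satisfy δ(ε) < 0, H(φ(x₁(ε), δ(ε))) = 0, and δ(ε) = -(4!/L_X⁴H(x*))^{1/4} ε^{1/4} + O(ε^{1/2}). Then, with v(ε) = L_XH(φ(x₁(ε), δ(ε))), one has φ(R(φ(x₁(ε), δ(ε))), -δ(ε)) = x₁(ε) + v(ε)·W(x₁(ε)) + O(ε) as ε → 0⁺; that is, all flow terms cancel up to order ε and only the reset correction remains. -/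

import Mathlib

open Filter Asymptotics Topology Set

/-- Iterated Lie derivative: `lieD X H 0 = H`, `lieD X H (k+1) x = D(lieD X H k)(x) · X x`. -/
noncomputable def lieD {n : ℕ} (X : EuclideanSpace ℝ (Fin n) → EuclideanSpace ℝ (Fin n))
    (H : EuclideanSpace ℝ (Fin n) → ℝ) : ℕ → EuclideanSpace ℝ (Fin n) → ℝ
  | 0 => H
  | k + 1 => fun x => fderiv ℝ (lieD X H k) x (X x)

/-- Two global solutions of the autonomous equation `ẋ = X x` with `X` of class `C¹` that agree at
one time agree everywhere. -/
theorem eq_of_hasDerivAt_autonomous {E : Type*} [NormedAddCommGroup E] [NormedSpace ℝ E]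
    {X : E → E} (hX : ContDiff ℝ 1 X) {f g : ℝ → E}
    (hf : ∀ t, HasDerivAt f (X (f t)) t) (hg : ∀ t, HasDerivAt g (X (g t)) t)
    {t₀ : ℝ} (h₀ : f t₀ = g t₀) : f = g := by
  have hfc : Continuous f := continuous_iff_continuousAt.2 fun t => (hf t).continuousAt
  have hgc : Continuous g := continuous_iff_continuousAt.2 fun t => (hg t).continuousAt
  have hopen : IsOpen {t | f t = g t} := by
    refine isOpen_iff_mem_nhds.2 fun t (ht : f t = g t) => ?_
    obtain ⟨K, s, hs, hK⟩ := (hX.contDiffAt (x := f t)).exists_lipschitzOnWith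
    refine ODE_solution_unique_of_eventually (v := fun _ => X) (s := fun _ => s)
      (.of_forall fun _ => hK) ?_ ?_ ht
    · filter_upwards [hfc.continuousAt hs] with r hr using ⟨hf r, hr⟩
    · filter_upwards [hgc.continuousAt (ht ▸ hs)] with r hr using ⟨hg r, hr⟩
  have huniv := IsClopen.eq_univ ⟨isClosed_eq hfc hgc, hopen⟩ ⟨t₀, h₀⟩
  exact funext fun t => huniv.symm.subset (mem_univ t)

/-- Flowing forward and then backward by the same time is the identity. -/
theorem flow_neg_cancel {E : Type*} [NormedAddCommGroup E] [NormedSpace ℝ E]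
    {X : E → E} (hX : ContDiff ℝ 1 X) {φ : E → ℝ → E} (hφ0 : ∀ x, φ x 0 = x)
    (hφ' : ∀ x t, HasDerivAt (φ x) (X (φ x t)) t) (x : E) (t : ℝ) :
    φ (φ x t) (-t) = x := by
  have h : (fun s => φ (φ x t) (s - t)) = φ x :=
    eq_of_hasDerivAt_autonomous hX (fun s => (hφ' _ (s - t)).comp_sub_const s t)
      (hφ' x) (t₀ := t) (by simp [hφ0])
  simpa [hφ0] using congrFun h 0

/-- If the time derivative of `u p t` is `O(b (p, t))` near `(p₀, 0)`, with `b` monotone in `|t|`,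
then `u p t - u p 0` is `O(|t| * b (p, t))`. -/
theorem isBigO_sub_initial_of_hasDerivAt {P F : Type*} [TopologicalSpace P]
    [NormedAddCommGroup F] [NormedSpace ℝ F] {u u' : P → ℝ → F} {b : P × ℝ → ℝ} {p₀ : P}
    (hu : ∀ p t, HasDerivAt (u p) (u' p t) t)
    (hb : ∀ p s t, |s| ≤ |t| → ‖b (p, s)‖ ≤ ‖b (p, t)‖)
    (hu' : (fun q : P × ℝ => u' q.1 q.2) =O[𝓝 (p₀, 0)] b) :
    (fun q : P × ℝ => u q.1 q.2 - u q.1 0) =O[𝓝 (p₀, 0)] fun q => |q.2| * b q := by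
  obtain ⟨C, hC, hbound⟩ := hu'.exists_pos
  have hbound := hbound.bound
  rw [nhds_prod_eq] at hbound ⊢
  obtain ⟨U, hU, V, hV, hUV⟩ := eventually_prod_iff.1 hbound
  obtain ⟨r, hr, hrV⟩ := Metric.eventually_nhds_iff.1 hV
  refine IsBigO.of_bound C ?_
  filter_upwards [prod_mem_prod hU (Metric.ball_mem_nhds (0 : ℝ) hr)] with ⟨p, t⟩ ⟨hp, ht⟩
  have ht' : |t| < r := by simpa using ht
  have habs : ∀ s ∈ uIcc 0 t, |s| ≤ |t| := fun s hs => by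
    simpa using abs_sub_left_of_mem_uIcc hs
  have hmvt := (convex_uIcc (𝕜 := ℝ) (0 : ℝ) t).norm_image_sub_le_of_norm_hasDerivWithin_le
    (f := u p) (C := C * ‖b (p, t)‖) (fun s _ => (hu p s).hasDerivWithinAt)
    (fun s hs => (hUV hp (hrV (by simpa using (habs s hs).trans_lt ht'))).trans
      (mul_le_mul_of_nonneg_left (hb p s t (habs s hs)) hC.le))
    left_mem_uIcc right_mem_uIcc
  refine hmvt.trans_eq ?_
  simp only [sub_zero, norm_mul, Real.norm_eq_abs, abs_abs]
  ring

/-- Two orbits of a `C¹` flow drift apart at a rate controlled by their initial distance. -/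
theorem isBigO_flow_sub_flow {E : Type*} [NormedAddCommGroup E] [NormedSpace ℝ E]
    {X : E → E} (hX : ContDiff ℝ 1 X) {φ : E → ℝ → E}
    (hφC1 : ContDiff ℝ 1 fun p : E × ℝ => φ p.1 p.2) (hφ0 : ∀ x, φ x 0 = x)
    (hφ' : ∀ x t, HasDerivAt (φ x) (X (φ x t)) t) (x₀ : E) :
    (fun q : (E × E) × ℝ => (φ q.1.1 q.2 - φ q.1.2 q.2) - (q.1.1 - q.1.2))
      =O[𝓝 ((x₀, x₀), 0)] fun q => |q.2| * ‖q.1.1 - q.1.2‖ := by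
  have hrate : (fun q : (E × E) × ℝ => X (φ q.1.1 q.2) - X (φ q.1.2 q.2))
      =O[𝓝 ((x₀, x₀), 0)] fun q => ‖q.1.1 - q.1.2‖ := by
    have hstrict := ((hX.comp hφC1).contDiffAt (x := (x₀, (0 : ℝ)))).hasStrictFDerivAt one_ne_zero
    have hlim : Tendsto (fun q : (E × E) × ℝ => ((q.1.1, q.2), (q.1.2, q.2)))
        (𝓝 ((x₀, x₀), 0)) (𝓝 ((x₀, 0), (x₀, 0))) :=
      Continuous.tendsto' (by fun_prop) _ _ rfl
    refine (hstrict.isBigO_sub.comp_tendsto hlim).trans (.of_bound 1 (.of_forall fun q => ?_))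
    simp [Prod.norm_def]
  simpa [hφ0] using isBigO_sub_initial_of_hasDerivAt
    (u := fun (p : E × E) t => φ p.1 t - φ p.2 t) (b := fun q => ‖q.1.1 - q.1.2‖)
    (fun p t => (hφ' p.1 t).sub (hφ' p.2 t)) (fun _ _ _ _ => le_rfl) hrate

/-- One integration step for the order of a function along a flow. -/
theorem isBigO_along_flow_succ {E : Type*} [NormedAddCommGroup E]
    {f g : E → ℝ → ℝ} {x₀ : E} {k : ℕ}
    (hfg : ∀ x t, HasDerivAt (f x) (g x t) t)
    (hf : (fun x => f x 0) =O[𝓝 x₀] fun x => x - x₀)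
    (hg : (fun q : E × ℝ => g q.1 q.2) =O[𝓝 (x₀, 0)] fun q => ‖q.1 - x₀‖ + |q.2| ^ k) :
    (fun q : E × ℝ => f q.1 q.2) =O[𝓝 (x₀, 0)] fun q => ‖q.1 - x₀‖ + |q.2| ^ (k + 1) := by
  have hmono : ∀ (x : E) (s t : ℝ), |s| ≤ |t| →
      ‖‖x - x₀‖ + |s| ^ k‖ ≤ ‖‖x - x₀‖ + |t| ^ k‖ := fun x s t hst => by
    rw [Real.norm_of_nonneg (by positivity), Real.norm_of_nonneg (by positivity)]
    gcongr
  have hincr := isBigO_sub_initial_of_hasDerivAt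
    (b := fun q : E × ℝ => ‖q.1 - x₀‖ + |q.2| ^ k) hfg hmono hg
  have hfst : Tendsto (Prod.fst : E × ℝ → E) (𝓝 (x₀, 0)) (𝓝 x₀) := continuous_fst.tendsto _
  have hinit : (fun q : E × ℝ => f q.1 0) =O[𝓝 (x₀, 0)] fun q => ‖q.1 - x₀‖ + |q.2| ^ (k + 1) :=
    (hf.comp_tendsto hfst).trans (.of_bound 1 (.of_forall fun q => by
      rw [Real.norm_of_nonneg (by positivity), one_mul]
      exact le_add_of_nonneg_right (by positivity)))
  have hsmall : ∀ᶠ q : E × ℝ in 𝓝 (x₀, 0), |q.2| < 1 :=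
    (Continuous.tendsto' (by fun_prop) _ _ (by simp) :
      Tendsto (fun q : E × ℝ => |q.2|) (𝓝 (x₀, 0)) (𝓝 0)).eventually_lt_const one_pos
  have hincr' : (fun q : E × ℝ => f q.1 q.2 - f q.1 0)
      =O[𝓝 (x₀, 0)] fun q => ‖q.1 - x₀‖ + |q.2| ^ (k + 1) := by
    refine hincr.trans (.of_bound 1 ?_)
    filter_upwards [hsmall] with q hq
    rw [Real.norm_of_nonneg (by positivity), Real.norm_of_nonneg (by positivity), one_mul, mul_add,
      pow_succ']
    gcongr
    exact mul_le_of_le_one_left (norm_nonneg _) hq.le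
  simpa using hincr'.add hinit

/-- Each Lie derivative costs one order of differentiability. -/
theorem ContDiff.lieD_succ {n : ℕ} {X : EuclideanSpace ℝ (Fin n) → EuclideanSpace ℝ (Fin n)}
    {H : EuclideanSpace ℝ (Fin n) → ℝ} {k : ℕ} {m m' : WithTop ℕ∞} (hX : ContDiff ℝ m' X)
    (hk : ContDiff ℝ m (lieD X H k)) (hm : m' + 1 ≤ m) : ContDiff ℝ m' (lieD X H (k + 1)) :=
  (hk.fderiv_right hm).clm_apply hX

/-- The Lie derivative is the derivative along orbits. -/
theorem hasDerivAt_lieD_flow {n : ℕ}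
    {X : EuclideanSpace ℝ (Fin n) → EuclideanSpace ℝ (Fin n)} {H : EuclideanSpace ℝ (Fin n) → ℝ}
    {φ : EuclideanSpace ℝ (Fin n) → ℝ → EuclideanSpace ℝ (Fin n)}
    (hφ' : ∀ x t, HasDerivAt (φ x) (X (φ x t)) t) {k : ℕ} (hk : Differentiable ℝ (lieD X H k))
    (x : EuclideanSpace ℝ (Fin n)) (t : ℝ) :
    HasDerivAt (fun s => lieD X H k (φ x s)) (lieD X H (k + 1) (φ x t)) t :=
  (hk _).hasFDerivAt.comp_hasDerivAt t (hφ' x t)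

/-- At a point where the first three Lie derivatives vanish, the first one is of third order in
time along nearby orbits. -/
theorem isBigO_lieD_one_flow {n : ℕ}
    {X : EuclideanSpace ℝ (Fin n) → EuclideanSpace ℝ (Fin n)} {H : EuclideanSpace ℝ (Fin n) → ℝ}
    {φ : EuclideanSpace ℝ (Fin n) → ℝ → EuclideanSpace ℝ (Fin n)}
    {xs : EuclideanSpace ℝ (Fin n)} (hX : ContDiff ℝ 3 X) (hH : ContDiff ℝ 4 H)
    (hφc : Continuous fun p : EuclideanSpace ℝ (Fin n) × ℝ => φ p.1 p.2)
    (hφ0 : ∀ x, φ x 0 = x) (hφ' : ∀ x t, HasDerivAt (φ x) (X (φ x t)) t)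
    (h1 : lieD X H 1 xs = 0) (h2 : lieD X H 2 xs = 0) (h3 : lieD X H 3 xs = 0) :
    (fun q : EuclideanSpace ℝ (Fin n) × ℝ => lieD X H 1 (φ q.1 q.2))
      =O[𝓝 (xs, 0)] fun q => ‖q.1 - xs‖ + |q.2| ^ 3 := by
  have hL1 : ContDiff ℝ 3 (lieD X H 1) := hX.lieD_succ (k := 0) hH (by norm_num)
  have hL2 : ContDiff ℝ 2 (lieD X H 2) := (hX.of_le (by norm_num)).lieD_succ hL1 (by norm_num)
  have hL3 : ContDiff ℝ 1 (lieD X H 3) := (hX.of_le (by norm_num)).lieD_succ hL2 (by norm_num)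
  have hL4 : ContDiff ℝ 0 (lieD X H 4) := (hX.of_le (by norm_num)).lieD_succ hL3 (by norm_num)
  have hd1 := hL1.differentiable (by norm_num)
  have hd2 := hL2.differentiable (by norm_num)
  have hd3 := hL3.differentiable (by norm_num)
  have hinit : ∀ k, Differentiable ℝ (lieD X H k) → lieD X H k xs = 0 →
      (fun x => lieD X H k (φ x 0)) =O[𝓝 xs] fun x => x - xs := fun k hk h0 => by
    simpa [h0, hφ0] using (hk xs).isBigO_sub
  have hbase : (fun q : EuclideanSpace ℝ (Fin n) × ℝ => lieD X H 4 (φ q.1 q.2))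
      =O[𝓝 (xs, 0)] fun q => ‖q.1 - xs‖ + |q.2| ^ 0 := by
    refine (((hL4.continuous.comp hφc).tendsto (xs, 0)).isBigO_one ℝ).trans
      (.of_bound 1 (.of_forall fun q => ?_))
    rw [Real.norm_of_nonneg (by positivity : (0 : ℝ) ≤ ‖q.1 - xs‖ + |q.2| ^ 0)]
    simp
  exact isBigO_along_flow_succ (hasDerivAt_lieD_flow hφ' hd1) (hinit 1 hd1 h1) <|
    isBigO_along_flow_succ (hasDerivAt_lieD_flow hφ' hd2) (hinit 2 hd2 h2) <|
    isBigO_along_flow_succ (hasDerivAt_lieD_flow hφ' hd3) (hinit 3 hd3 h3) hbase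

/-- **Cancellation identity for the ZDM.** With `v(ε) = L_XH(φ(x₁(ε), δ(ε)))`, one has
`φ(R(φ(x₁(ε), δ(ε))), -δ(ε)) = x₁(ε) + v(ε)·W(x₁(ε)) + O(ε)` as `ε → 0⁺`:
all flow terms cancel up to order `ε` and only the reset correction remains. -/
theorem zdm_cancellation {n : ℕ}
    (X W : EuclideanSpace ℝ (Fin n) → EuclideanSpace ℝ (Fin n))
    (H : EuclideanSpace ℝ (Fin n) → ℝ)
    (R : EuclideanSpace ℝ (Fin n) → EuclideanSpace ℝ (Fin n))
    (φ : EuclideanSpace ℝ (Fin n) → ℝ → EuclideanSpace ℝ (Fin n))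
    (xs : EuclideanSpace ℝ (Fin n))
    (hX : ContDiff ℝ 3 X) (hH : ContDiff ℝ (⊤ : ℕ∞) H) (hW : ContDiff ℝ (⊤ : ℕ∞) W)
    (hR : ∀ x, R x = x + (lieD X H 1 x) • W x)
    (hφC1 : ContDiff ℝ 1 fun p : EuclideanSpace ℝ (Fin n) × ℝ => φ p.1 p.2)
    (hφ0 : ∀ x, φ x 0 = x)
    (hφ' : ∀ x t, HasDerivAt (φ x) (X (φ x t)) t)
    (hxsOnSigma : H xs = 0)
    (h1 : lieD X H 1 xs = 0) (h2 : lieD X H 2 xs = 0) (h3 : lieD X H 3 xs = 0)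
    (h4 : 0 < lieD X H 4 xs)
    (ε₀ : ℝ) (hε₀ : 0 < ε₀)
    (x₁ : ℝ → EuclideanSpace ℝ (Fin n))
    (hx₁Pi3 : ∀ ε ∈ Ioo 0 ε₀, lieD X H 3 (x₁ ε) = 0)
    (hx₁H : ∀ ε ∈ Ioo 0 ε₀, H (x₁ ε) = -ε)
    (hx₁O : (fun ε => x₁ ε - xs) =O[𝓝[>] (0:ℝ)] fun ε => ε)
    (δ : ℝ → ℝ)
    (hδneg : ∀ ε ∈ Ioo 0 ε₀, δ ε < 0)
    (hitSigma : ∀ ε ∈ Ioo 0 ε₀, H (φ (x₁ ε) (δ ε)) = 0)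
    (hδO : (fun ε => δ ε + ((24:ℝ) / lieD X H 4 xs) ^ ((1:ℝ)/4) * ε ^ ((1:ℝ)/4))
        =O[𝓝[>] (0:ℝ)] fun ε => ε ^ ((1:ℝ)/2)) :
    (fun ε => φ (R (φ (x₁ ε) (δ ε))) (-(δ ε))
        - (x₁ ε + (lieD X H 1 (φ (x₁ ε) (δ ε))) • W (x₁ ε)))
      =O[𝓝[>] (0:ℝ)] fun ε => ε := by
  have hX1 : ContDiff ℝ 1 X := hX.of_le (by norm_num)
  have hW1 : ContDiff ℝ 1 W := hW.of_le (by exact_mod_cast le_top)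
  have hε : Tendsto (fun ε : ℝ => ε) (𝓝[>] (0:ℝ)) (𝓝 0) :=
    tendsto_nhdsWithin_of_tendsto_nhds tendsto_id
  have hpos : ∀ᶠ ε : ℝ in 𝓝[>] (0:ℝ), 0 < ε := self_mem_nhdsWithin
  have hx₁lim : Tendsto x₁ (𝓝[>] 0) (𝓝 xs) := tendsto_sub_nhds_zero_iff.1 (hx₁O.trans_tendsto hε)
  have hδquarter : δ =O[𝓝[>] (0:ℝ)] fun ε => ε ^ ((1:ℝ)/4) := by
    have hhalf : (fun ε : ℝ => ε ^ ((1:ℝ)/2)) =O[𝓝[>] (0:ℝ)] fun ε => ε ^ ((1:ℝ)/4) := by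
      refine .of_bound 1 ?_
      filter_upwards [hpos, hε.eventually_lt_const one_pos] with ε h0 h1
      rw [Real.norm_of_nonneg (by positivity), Real.norm_of_nonneg (by positivity), one_mul]
      exact Real.rpow_le_rpow_of_exponent_ge h0 h1.le (by norm_num)
    exact ((hδO.trans hhalf).sub (isBigO_const_mul_self _ _ _)).congr_left fun ε =>
      add_sub_cancel_right _ _
  have hδfour : (fun ε => |δ ε| ^ 4) =O[𝓝[>] (0:ℝ)] fun ε => ε := by
    refine (hδquarter.abs_left.pow 4).congr' .rfl ?_
    filter_upwards [hpos] with ε h0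
    rw [← Real.rpow_natCast, ← Real.rpow_mul h0.le]
    norm_num
  have hδlim : Tendsto δ (𝓝[>] 0) (𝓝 0) := by
    refine hδquarter.trans_tendsto ?_
    have := hε.rpow_const (p := (1:ℝ)/4) (Or.inr (by norm_num))
    rwa [Real.zero_rpow (by norm_num)] at this
  have hxδ : Tendsto (fun ε => (x₁ ε, δ ε)) (𝓝[>] 0) (𝓝 (xs, 0)) := hx₁lim.prodMk_nhds hδlim
  set y : ℝ → EuclideanSpace ℝ (Fin n) := fun ε => φ (x₁ ε) (δ ε) with hy
  set v : ℝ → ℝ := fun ε => lieD X H 1 (y ε) with hv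
  have hylim : Tendsto y (𝓝[>] 0) (𝓝 xs) := by
    simpa [hφ0, Function.comp_def] using (hφC1.continuous.tendsto (xs, 0)).comp hxδ
  have hvO : v =O[𝓝[>] (0:ℝ)] fun ε => ‖x₁ ε - xs‖ + |δ ε| ^ 3 :=
    (isBigO_lieD_one_flow hX (contDiff_infty.1 hH 4) hφC1.continuous hφ0 hφ'
      h1 h2 h3).comp_tendsto hxδ
  have hvlim : Tendsto v (𝓝[>] 0) (𝓝 0) := by
    have hlim := (tendsto_sub_nhds_zero_iff.2 hx₁lim).norm.add (hδlim.abs.pow 3)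
    exact hvO.trans_tendsto (by simpa using hlim)
  have hδv : (fun ε => |δ ε| * v ε) =O[𝓝[>] (0:ℝ)] fun ε => ε := by
    refine ((isBigO_refl (fun ε => |δ ε|) _).mul hvO).trans ?_
    have hfirst : (fun ε => |δ ε| * ‖x₁ ε - xs‖) =O[𝓝[>] (0:ℝ)] fun ε => ε := by
      simpa using (hδlim.abs.isBigO_one ℝ).mul hx₁O.norm_left
    refine (hfirst.add hδfour).congr_left fun ε => ?_
    ring
  have hWy : Tendsto (fun ε => W (y ε)) (𝓝[>] 0) (𝓝 (W xs)) :=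
    (hW.continuous.tendsto xs).comp hylim
  have hkick : (fun ε => (φ (y ε + v ε • W (y ε)) (-(δ ε)) - φ (y ε) (-(δ ε)))
      - ((y ε + v ε • W (y ε)) - y ε)) =O[𝓝[>] (0:ℝ)] fun ε => ε := by
    have hRlim : Tendsto (fun ε => y ε + v ε • W (y ε)) (𝓝[>] 0) (𝓝 xs) := by
      simpa using hylim.add (hvlim.smul hWy)
    have hneg : Tendsto (fun ε => -(δ ε)) (𝓝[>] 0) (𝓝 0) := by simpa using hδlim.neg
    have hdrift := (isBigO_flow_sub_flow hX1 hφC1 hφ0 hφ' xs).comp_tendsto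
      ((hRlim.prodMk_nhds hylim).prodMk_nhds hneg)
    refine hdrift.trans ?_
    have hprod := hδv.norm_left.mul (hWy.norm.isBigO_one ℝ)
    simpa [Function.comp_def, norm_smul, mul_assoc] using hprod
  have hWdiff : (fun ε => v ε • (W (y ε) - W (x₁ ε))) =O[𝓝[>] (0:ℝ)] fun ε => ε := by
    have hstrict :=
      ((hW1.comp hφC1).contDiffAt (x := (xs, (0 : ℝ)))).hasStrictFDerivAt one_ne_zero
    have hx0 : Tendsto (fun ε => (x₁ ε, (0 : ℝ))) (𝓝[>] 0) (𝓝 (xs, 0)) :=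
      hx₁lim.prodMk_nhds tendsto_const_nhds
    have hW' : (fun ε => W (y ε) - W (x₁ ε)) =O[𝓝[>] (0:ℝ)] δ := by
      refine (hstrict.isBigO_sub.comp_tendsto (hxδ.prodMk_nhds hx0)).congr_left
        (fun ε => by simp [hy, hφ0]) |>.trans (.of_bound 1 (.of_forall fun ε => ?_))
      simp [Prod.norm_def]
    refine ((isBigO_refl v _).smul hW').trans (hδv.norm_left.congr_left fun ε => ?_).of_norm_left
    simp [mul_comm]
  refine (hkick.add hWdiff).congr_left fun ε => ?_
  rw [hR, flow_neg_cancel hX1 hφ0 hφ', smul_sub]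
  abel
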